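/- For each i ∈ {1,2,3}, the function Lᵢ Poisson commutes with the generalized Kepler–Coulomb Hamiltonian H^GKC_i at every point of D: {L₁, H^GKC_1} = {L₂, H^GKC_2} = {L₃, H^GKC_3} = 0. -/

import Mathlib

namespace Paper
noncomputable section

/-- The κ-dependent cosine Cκ(x) = ∑ (−κ)^l x^{2l}/(2l)!. -/
def Ck (κ x : ℝ) : ℝ := ∑' l : ℕ, (-κ) ^ l * x ^ (2 * l) / (Nat.factorial (2 * l) : ℝ)

/-- The κ-dependent sine Sκ(x) = ∑ (−κ)^l x^{2l+1}/(2l+1)!. -/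
def Sk (κ x : ℝ) : ℝ := ∑' l : ℕ, (-κ) ^ l * x ^ (2 * l + 1) / (Nat.factorial (2 * l + 1) : ℝ)

/-- The κ-dependent tangent Tκ(x) = Sκ(x)/Cκ(x). -/
def Tk (κ x : ℝ) : ℝ := Sk κ x / Ck κ x

/-- Phase space ℝ³ × ℝ³ ≃ ℝ⁶ with canonical coordinates
`(r, θ, φ, p_r, p_θ, p_φ) = (x 0, x 1, x 2, x 3, x 4, x 5)`. -/
abbrev Pt := Fin 6 → ℝ

/-- Partial derivative in the i-th coordinate direction. -/
def pd (f : Pt → ℝ) (i : Fin 6) (x : Pt) : ℝ := fderiv ℝ f x (Pi.single i 1)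

/-- Canonical Poisson bracket {f,g} = ∑_{q} (∂f/∂q ∂g/∂p_q − ∂g/∂q ∂f/∂p_q). -/
def pb (f g : Pt → ℝ) (x : Pt) : ℝ :=
  ∑ i : Fin 3,
    (pd f ⟨i.1, by omega⟩ x * pd g ⟨i.1 + 3, by omega⟩ x
      - pd g ⟨i.1, by omega⟩ x * pd f ⟨i.1 + 3, by omega⟩ x)

/-- Gradient of a function on phase space, as a vector in ℝ⁶. -/
def grad (f : Pt → ℝ) (x : Pt) : Fin 6 → ℝ := fun i => pd f i x

/-- The open domain D where Sκ₁(r), Cκ₁(r), Sκ₂(θ), Cκ₂(θ), cos φ, sin φ are nonzero. -/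
def D (κ₁ κ₂ : ℝ) : Set Pt :=
  {x | Sk κ₁ (x 0) ≠ 0 ∧ Ck κ₁ (x 0) ≠ 0 ∧ Sk κ₂ (x 1) ≠ 0 ∧ Ck κ₂ (x 1) ≠ 0 ∧
       Real.cos (x 2) ≠ 0 ∧ Real.sin (x 2) ≠ 0}

/-- J₀₁ = Cκ₂(θ)p_r − (Sκ₂(θ)/Tκ₁(r))p_θ. -/
def J01 (κ₁ κ₂ : ℝ) (x : Pt) : ℝ :=
  Ck κ₂ (x 1) * x 3 - (Sk κ₂ (x 1) / Tk κ₁ (x 0)) * x 4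

/-- J₀₂. -/
def J02 (κ₁ κ₂ : ℝ) (x : Pt) : ℝ :=
  κ₂ * Sk κ₂ (x 1) * Real.cos (x 2) * x 3
    + (Ck κ₂ (x 1) * Real.cos (x 2) / Tk κ₁ (x 0)) * x 4
    - (Real.sin (x 2) / (Tk κ₁ (x 0) * Sk κ₂ (x 1))) * x 5

/-- J₀₃. -/
def J03 (κ₁ κ₂ : ℝ) (x : Pt) : ℝ :=
  κ₂ * Sk κ₂ (x 1) * Real.sin (x 2) * x 3
    + (Ck κ₂ (x 1) * Real.sin (x 2) / Tk κ₁ (x 0)) * x 4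
    + (Real.cos (x 2) / (Tk κ₁ (x 0) * Sk κ₂ (x 1))) * x 5

/-- J₁₂ = cos φ·p_θ − (sin φ/Tκ₂(θ))p_φ. -/
def J12 (κ₂ : ℝ) (x : Pt) : ℝ :=
  Real.cos (x 2) * x 4 - (Real.sin (x 2) / Tk κ₂ (x 1)) * x 5

/-- J₁₃ = sin φ·p_θ + (cos φ/Tκ₂(θ))p_φ. -/
def J13 (κ₂ : ℝ) (x : Pt) : ℝ :=
  Real.sin (x 2) * x 4 + (Real.cos (x 2) / Tk κ₂ (x 1)) * x 5

/-- J₂₃ = p_φ. -/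
def J23 (x : Pt) : ℝ := x 5

/-- Kinetic energy T. -/
def Tkin (κ₁ κ₂ : ℝ) (x : Pt) : ℝ :=
  (1 / 2) * ((x 3) ^ 2 + (x 4) ^ 2 / (κ₂ * Sk κ₁ (x 0) ^ 2)
    + (x 5) ^ 2 / (κ₂ * Sk κ₁ (x 0) ^ 2 * Sk κ₂ (x 1) ^ 2))

/-- The superintegrable potential U with arbitrary radial function F. -/
def U (κ₁ κ₂ : ℝ) (F : ℝ → ℝ) (β₁ β₂ β₃ : ℝ) (x : Pt) : ℝ :=
  F (x 0) + (1 / Sk κ₁ (x 0) ^ 2) *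
    (β₁ / Ck κ₂ (x 1) ^ 2 + β₂ / (Sk κ₂ (x 1) ^ 2 * Real.cos (x 2) ^ 2)
      + β₃ / (Sk κ₂ (x 1) ^ 2 * Real.sin (x 2) ^ 2))

/-- Integral I₁₂. -/
def I12 (κ₂ β₁ β₂ : ℝ) (x : Pt) : ℝ :=
  (Real.cos (x 2) * x 4 - (Real.sin (x 2) / Tk κ₂ (x 1)) * x 5) ^ 2
    + 2 * β₁ * κ₂ ^ 2 * Tk κ₂ (x 1) ^ 2 * Real.cos (x 2) ^ 2
    + 2 * β₂ * κ₂ / (Tk κ₂ (x 1) ^ 2 * Real.cos (x 2) ^ 2)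

/-- Integral I₁₃. -/
def I13 (κ₂ β₁ β₃ : ℝ) (x : Pt) : ℝ :=
  (Real.sin (x 2) * x 4 + (Real.cos (x 2) / Tk κ₂ (x 1)) * x 5) ^ 2
    + 2 * β₁ * κ₂ ^ 2 * Tk κ₂ (x 1) ^ 2 * Real.sin (x 2) ^ 2
    + 2 * β₃ * κ₂ / (Tk κ₂ (x 1) ^ 2 * Real.sin (x 2) ^ 2)

/-- Integral I₂₃. -/
def I23 (κ₂ β₂ β₃ : ℝ) (x : Pt) : ℝ :=
  (x 5) ^ 2 + 2 * β₂ * κ₂ * Real.tan (x 2) ^ 2 + 2 * β₃ * κ₂ / Real.tan (x 2) ^ 2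

/-- Integral I₁₂₃. -/
def I123 (κ₂ β₁ β₂ β₃ : ℝ) (x : Pt) : ℝ :=
  (x 4) ^ 2 + (x 5) ^ 2 / Sk κ₂ (x 1) ^ 2 + 2 * β₁ * κ₂ / Ck κ₂ (x 1) ^ 2
    + 2 * β₂ * κ₂ / (Sk κ₂ (x 1) ^ 2 * Real.cos (x 2) ^ 2)
    + 2 * β₃ * κ₂ / (Sk κ₂ (x 1) ^ 2 * Real.sin (x 2) ^ 2)

/-- The Smorodinsky–Winternitz Hamiltonian H^SW. -/
def HSW (κ₁ κ₂ β₀ β₁ β₂ β₃ : ℝ) (x : Pt) : ℝ :=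
  Tkin κ₁ κ₂ x + β₀ * Tk κ₁ (x 0) ^ 2 + (1 / Sk κ₁ (x 0) ^ 2) *
    (β₁ / Ck κ₂ (x 1) ^ 2 + β₂ / (Sk κ₂ (x 1) ^ 2 * Real.cos (x 2) ^ 2)
      + β₃ / (Sk κ₂ (x 1) ^ 2 * Real.sin (x 2) ^ 2))

/-- Integral I₀₁ of H^SW. -/
def I01 (κ₁ κ₂ β₀ β₁ : ℝ) (x : Pt) : ℝ :=
  J01 κ₁ κ₂ x ^ 2 + 2 * β₀ * Tk κ₁ (x 0) ^ 2 * Ck κ₂ (x 1) ^ 2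
    + 2 * β₁ / (Tk κ₁ (x 0) ^ 2 * Ck κ₂ (x 1) ^ 2)

/-- Integral I₀₂ of H^SW. -/
def I02 (κ₁ κ₂ β₀ β₂ : ℝ) (x : Pt) : ℝ :=
  J02 κ₁ κ₂ x ^ 2 + 2 * β₀ * κ₂ ^ 2 * Tk κ₁ (x 0) ^ 2 * Sk κ₂ (x 1) ^ 2 * Real.cos (x 2) ^ 2
    + 2 * β₂ * κ₂ / (Tk κ₁ (x 0) ^ 2 * Sk κ₂ (x 1) ^ 2 * Real.cos (x 2) ^ 2)

/-- Integral I₀₃ of H^SW. -/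
def I03 (κ₁ κ₂ β₀ β₃ : ℝ) (x : Pt) : ℝ :=
  J03 κ₁ κ₂ x ^ 2 + 2 * β₀ * κ₂ ^ 2 * Tk κ₁ (x 0) ^ 2 * Sk κ₂ (x 1) ^ 2 * Real.sin (x 2) ^ 2
    + 2 * β₃ * κ₂ / (Tk κ₁ (x 0) ^ 2 * Sk κ₂ (x 1) ^ 2 * Real.sin (x 2) ^ 2)

/-- Generalized Kepler–Coulomb Hamiltonian H^GKC₁ = T + U^GKC₁. -/
def HGKC1 (κ₁ κ₂ k β₂ β₃ : ℝ) (x : Pt) : ℝ :=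
  Tkin κ₁ κ₂ x - k / Tk κ₁ (x 0)
    + (1 / (Sk κ₁ (x 0) ^ 2 * Sk κ₂ (x 1) ^ 2)) *
        (β₂ / Real.cos (x 2) ^ 2 + β₃ / Real.sin (x 2) ^ 2)

/-- Generalized Kepler–Coulomb Hamiltonian H^GKC₂ = T + U^GKC₂. -/
def HGKC2 (κ₁ κ₂ k β₁ β₃ : ℝ) (x : Pt) : ℝ :=
  Tkin κ₁ κ₂ x - k / Tk κ₁ (x 0)
    + (1 / Sk κ₁ (x 0) ^ 2) *
        (β₁ / Ck κ₂ (x 1) ^ 2 + β₃ / (Sk κ₂ (x 1) ^ 2 * Real.sin (x 2) ^ 2))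

/-- Generalized Kepler–Coulomb Hamiltonian H^GKC₃ = T + U^GKC₃. -/
def HGKC3 (κ₁ κ₂ k β₁ β₂ : ℝ) (x : Pt) : ℝ :=
  Tkin κ₁ κ₂ x - k / Tk κ₁ (x 0)
    + (1 / Sk κ₁ (x 0) ^ 2) *
        (β₁ / Ck κ₂ (x 1) ^ 2 + β₂ / (Sk κ₂ (x 1) ^ 2 * Real.cos (x 2) ^ 2))

/-- The function L₁. -/
def L1 (κ₁ κ₂ k β₂ β₃ : ℝ) (x : Pt) : ℝ :=
  -(J02 κ₁ κ₂ x * J12 κ₂ x) - J03 κ₁ κ₂ x * J13 κ₂ x + k * κ₂ * Ck κ₂ (x 1)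
    - (2 * κ₂ * Ck κ₂ (x 1) / (Tk κ₁ (x 0) * Sk κ₂ (x 1) ^ 2)) *
        (β₂ / Real.cos (x 2) ^ 2 + β₃ / Real.sin (x 2) ^ 2)

/-- The function L₂. -/
def L2 (κ₁ κ₂ k β₁ β₃ : ℝ) (x : Pt) : ℝ :=
  J01 κ₁ κ₂ x * J12 κ₂ x - J03 κ₁ κ₂ x * J23 x + k * κ₂ * Sk κ₂ (x 1) * Real.cos (x 2)
    - (2 * κ₂ * Real.cos (x 2) / Tk κ₁ (x 0)) *
        (β₁ * Sk κ₂ (x 1) / Ck κ₂ (x 1) ^ 2 + β₃ / (Sk κ₂ (x 1) * Real.sin (x 2) ^ 2))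

/-- The function L₃. -/
def L3 (κ₁ κ₂ k β₁ β₂ : ℝ) (x : Pt) : ℝ :=
  J01 κ₁ κ₂ x * J13 κ₂ x + J02 κ₁ κ₂ x * J23 x + k * κ₂ * Sk κ₂ (x 1) * Real.sin (x 2)
    - (2 * κ₂ * Real.sin (x 2) / Tk κ₁ (x 0)) *
        (β₁ * Sk κ₂ (x 1) / Ck κ₂ (x 1) ^ 2 + β₂ / (Sk κ₂ (x 1) * Real.cos (x 2) ^ 2))

theorem Ck_of_pos {κ : ℝ} (hκ : 0 < κ) (x : ℝ) : Ck κ x = Real.cos (√κ * x) := by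
  rw [(Real.hasSum_cos (√κ * x)).tsum_eq.symm, Ck]
  refine tsum_congr fun l => ?_
  rw [mul_pow, pow_mul √κ, Real.sq_sqrt hκ.le, neg_pow]
  ring

theorem Sk_of_pos {κ : ℝ} (hκ : 0 < κ) (x : ℝ) : Sk κ x = Real.sin (√κ * x) / √κ := by
  have h : √κ ≠ 0 := (Real.sqrt_pos.2 hκ).ne'
  rw [(Real.hasSum_sin (√κ * x)).tsum_eq.symm, Sk, ← tsum_div_const]
  refine tsum_congr fun l => ?_
  rw [mul_pow, pow_succ √κ, pow_mul √κ, Real.sq_sqrt hκ.le, neg_pow]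
  field_simp

theorem Ck_of_neg {κ : ℝ} (hκ : κ < 0) (x : ℝ) : Ck κ x = Real.cosh (√(-κ) * x) := by
  rw [(Real.hasSum_cosh (√(-κ) * x)).tsum_eq.symm, Ck]
  refine tsum_congr fun l => ?_
  rw [mul_pow, pow_mul √(-κ), Real.sq_sqrt (neg_pos.2 hκ).le]

theorem Sk_of_neg {κ : ℝ} (hκ : κ < 0) (x : ℝ) : Sk κ x = Real.sinh (√(-κ) * x) / √(-κ) := by
  have h : √(-κ) ≠ 0 := (Real.sqrt_pos.2 (neg_pos.2 hκ)).ne'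
  rw [(Real.hasSum_sinh (√(-κ) * x)).tsum_eq.symm, Sk, ← tsum_div_const]
  refine tsum_congr fun l => ?_
  rw [mul_pow, pow_succ √(-κ), pow_mul √(-κ), Real.sq_sqrt (neg_pos.2 hκ).le]
  field_simp

theorem Ck_zero (x : ℝ) : Ck 0 x = 1 := by
  rw [Ck, tsum_eq_single 0]
  · simp
  · intro l hl
    simp [hl]

theorem Sk_zero (x : ℝ) : Sk 0 x = x := by
  rw [Sk, tsum_eq_single 0]
  · simp
  · intro l hl
    simp [hl]

theorem Ck_sq_add_Sk_sq (κ x : ℝ) : Ck κ x ^ 2 + κ * Sk κ x ^ 2 = 1 := by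
  rcases lt_trichotomy κ 0 with hκ | rfl | hκ
  · have h : √(-κ) ≠ 0 := (Real.sqrt_pos.2 (neg_pos.2 hκ)).ne'
    rw [Ck_of_neg hκ, Sk_of_neg hκ, div_pow, Real.sq_sqrt (neg_pos.2 hκ).le, Real.cosh_sq]
    field_simp [hκ.ne]
    ring
  · simp [Ck_zero]
  · rw [Ck_of_pos hκ, Sk_of_pos hκ, div_pow, Real.sq_sqrt hκ.le, mul_div_cancel₀ _ hκ.ne',
      Real.cos_sq_add_sin_sq]

theorem hasDerivAt_Ck (κ x : ℝ) : HasDerivAt (Ck κ) (-(κ * Sk κ x)) x := by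
  rcases lt_trichotomy κ 0 with hκ | rfl | hκ
  · have h : √(-κ) ≠ 0 := (Real.sqrt_pos.2 (neg_pos.2 hκ)).ne'
    rw [funext (Ck_of_neg hκ), Sk_of_neg hκ]
    refine (hasDerivAt_const_mul √(-κ)).cosh.congr_deriv ?_
    field_simp
    rw [Real.sq_sqrt (neg_pos.2 hκ).le]
    ring
  · simpa [funext Ck_zero] using hasDerivAt_const x (1 : ℝ)
  · have h : √κ ≠ 0 := (Real.sqrt_pos.2 hκ).ne'
    rw [funext (Ck_of_pos hκ), Sk_of_pos hκ]
    refine (hasDerivAt_const_mul √κ).cos.congr_deriv ?_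
    field_simp
    rw [Real.sq_sqrt hκ.le, mul_comm]

theorem hasDerivAt_Sk (κ x : ℝ) : HasDerivAt (Sk κ) (Ck κ x) x := by
  rcases lt_trichotomy κ 0 with hκ | rfl | hκ
  · have h : √(-κ) ≠ 0 := (Real.sqrt_pos.2 (neg_pos.2 hκ)).ne'
    rw [funext (Sk_of_neg hκ), Ck_of_neg hκ]
    exact ((hasDerivAt_const_mul √(-κ)).sinh.div_const √(-κ)).congr_deriv
      (mul_div_cancel_right₀ _ h)
  · rw [funext Sk_zero, Ck_zero]
    exact hasDerivAt_id' x
  · have h : √κ ≠ 0 := (Real.sqrt_pos.2 hκ).ne'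
    rw [funext (Sk_of_pos hκ), Ck_of_pos hκ]
    exact ((hasDerivAt_const_mul √κ).sin.div_const √κ).congr_deriv
      (mul_div_cancel_right₀ _ h)

theorem hasDerivAt_inv_Tk {κ x : ℝ} (hS : Sk κ x ≠ 0) :
    HasDerivAt (fun y => (Tk κ y)⁻¹) (-((Sk κ x)⁻¹ ^ 2)) x := by
  simp only [Tk, inv_div]
  refine ((hasDerivAt_Ck κ x).fun_div (hasDerivAt_Sk κ x) hS).congr_deriv ?_
  field_simp
  linear_combination -Ck_sq_add_Sk_sq κ x

theorem hasDerivAt_inv_Sk {κ x : ℝ} (hS : Sk κ x ≠ 0) :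
    HasDerivAt (fun y => (Sk κ y)⁻¹) (-(Tk κ x)⁻¹ * (Sk κ x)⁻¹) x := by
  refine ((hasDerivAt_Sk κ x).fun_inv hS).congr_deriv ?_
  rw [Tk, inv_div]
  field_simp

theorem hasDerivAt_inv_Ck {κ x : ℝ} (hC : Ck κ x ≠ 0) :
    HasDerivAt (fun y => (Ck κ y)⁻¹) (κ * Sk κ x * (Ck κ x)⁻¹ ^ 2) x := by
  refine ((hasDerivAt_Ck κ x).fun_inv hC).congr_deriv ?_
  field_simp

theorem hasDerivAt_inv_cos {x : ℝ} (hc : Real.cos x ≠ 0) :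
    HasDerivAt (fun y => (Real.cos y)⁻¹) (Real.sin x * (Real.cos x)⁻¹ ^ 2) x := by
  refine ((Real.hasDerivAt_cos x).fun_inv hc).congr_deriv ?_
  field_simp

theorem hasDerivAt_inv_sin {x : ℝ} (hs : Real.sin x ≠ 0) :
    HasDerivAt (fun y => (Real.sin y)⁻¹) (-Real.cos x * (Real.sin x)⁻¹ ^ 2) x := by
  refine ((Real.hasDerivAt_sin x).fun_inv hs).congr_deriv ?_
  field_simp

/-- `f` is differentiable at `x` and `g` is its tuple of partial derivatives there. -/
def HasGrad (f : Pt → ℝ) (g : Fin 6 → ℝ) (x : Pt) : Prop :=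
  DifferentiableAt ℝ f x ∧ ∀ i, pd f i x = g i

namespace HasGrad

variable {f₁ f₂ : Pt → ℝ} {g₁ g₂ : Fin 6 → ℝ} {x : Pt}

theorem const (c : ℝ) (x : Pt) : HasGrad (fun _ => c) 0 x :=
  ⟨differentiableAt_const c, fun i => by simp [pd]⟩

theorem coord (j : Fin 6) (x : Pt) : HasGrad (fun y => y j) (Pi.single j 1) x := by
  have h : HasFDerivAt (fun y : Pt => y j) (ContinuousLinearMap.proj (R := ℝ) j) x :=
    hasFDerivAt_apply j x
  refine ⟨h.differentiableAt, fun i => ?_⟩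
  rw [pd, h.fderiv, ContinuousLinearMap.proj_apply]
  simp only [Pi.single_apply, eq_comm]

theorem comp_coord {f : ℝ → ℝ} {f' : ℝ} {j : Fin 6} (hf : HasDerivAt f f' (x j)) :
    HasGrad (fun y => f (y j)) (Pi.single j f') x := by
  have hj : HasFDerivAt (fun y : Pt => y j) (ContinuousLinearMap.proj (R := ℝ) j) x :=
    hasFDerivAt_apply j x
  have h : HasFDerivAt (fun y : Pt => f (y j)) _ x := hf.comp_hasFDerivAt x hj
  refine ⟨h.differentiableAt, fun i => ?_⟩
  rw [pd, h.fderiv]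
  by_cases hij : i = j <;> simp [hij]

theorem add (h₁ : HasGrad f₁ g₁ x) (h₂ : HasGrad f₂ g₂ x) :
    HasGrad (fun y => f₁ y + f₂ y) (g₁ + g₂) x := by
  refine ⟨h₁.1.add h₂.1, fun i => ?_⟩
  rw [Pi.add_apply, ← h₁.2, ← h₂.2, pd, fderiv_fun_add h₁.1 h₂.1]
  rfl

theorem sub (h₁ : HasGrad f₁ g₁ x) (h₂ : HasGrad f₂ g₂ x) :
    HasGrad (fun y => f₁ y - f₂ y) (g₁ - g₂) x := by
  refine ⟨h₁.1.sub h₂.1, fun i => ?_⟩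
  rw [Pi.sub_apply, ← h₁.2, ← h₂.2, pd, fderiv_fun_sub h₁.1 h₂.1]
  rfl

theorem mul (h₁ : HasGrad f₁ g₁ x) (h₂ : HasGrad f₂ g₂ x) :
    HasGrad (fun y => f₁ y * f₂ y) (f₁ x • g₂ + f₂ x • g₁) x := by
  refine ⟨h₁.1.mul h₂.1, fun i => ?_⟩
  rw [Pi.add_apply, Pi.smul_apply, Pi.smul_apply, ← h₁.2, ← h₂.2, pd,
    fderiv_fun_mul h₁.1 h₂.1]
  rfl

theorem congr (h : HasGrad f₁ g₁ x) (hf : ∀ y, f₂ y = f₁ y) (hg : ∀ i, g₂ i = g₁ i) :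
    HasGrad f₂ g₂ x := by
  rwa [funext hf, funext hg]

theorem pb_eq (h₁ : HasGrad f₁ g₁ x) (h₂ : HasGrad f₂ g₂ x) :
    pb f₁ f₂ x = g₁ 0 * g₂ 3 - g₂ 0 * g₁ 3 + (g₁ 1 * g₂ 4 - g₂ 1 * g₁ 4)
      + (g₁ 2 * g₂ 5 - g₂ 2 * g₁ 5) := by
  simp only [pb, h₁.2, h₂.2, Fin.sum_univ_three]
  rfl

end HasGrad

section Gradients

variable {κ₁ κ₂ : ℝ} {x : Pt}

theorem hasGrad_J01 (h₁ : Sk κ₁ (x 0) ≠ 0) :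
    HasGrad (J01 κ₁ κ₂) ![Sk κ₂ (x 1) * (Sk κ₁ (x 0))⁻¹ ^ 2 * x 4,
      -(κ₂ * Sk κ₂ (x 1) * x 3) - Ck κ₂ (x 1) * (Tk κ₁ (x 0))⁻¹ * x 4,
      0,
      Ck κ₂ (x 1),
      -(Sk κ₂ (x 1) * (Tk κ₁ (x 0))⁻¹),
      0] x := by
  have u := HasGrad.comp_coord (j := 0) (hasDerivAt_inv_Tk h₁)
  have S := HasGrad.comp_coord (j := 1) (hasDerivAt_Sk κ₂ (x 1))
  have C := HasGrad.comp_coord (j := 1) (hasDerivAt_Ck κ₂ (x 1))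
  have p := HasGrad.coord 3 x
  have q := HasGrad.coord 4 x
  refine ((C.mul p).sub ((S.mul u).mul q)).congr (fun y => ?_) fun i => ?_
  · simp only [J01, div_eq_mul_inv]
  · fin_cases i <;> simp <;> ring

theorem hasGrad_J02 (h₁ : Sk κ₁ (x 0) ≠ 0) (h₂ : Sk κ₂ (x 1) ≠ 0) :
    HasGrad (J02 κ₁ κ₂) ![Real.sin (x 2) * (Sk κ₂ (x 1))⁻¹ * (Sk κ₁ (x 0))⁻¹ ^ 2 * x 5 -
      Ck κ₂ (x 1) * Real.cos (x 2) * (Sk κ₁ (x 0))⁻¹ ^ 2 * x 4,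
      κ₂ * Ck κ₂ (x 1) * Real.cos (x 2) * x 3 -
        κ₂ * Sk κ₂ (x 1) * Real.cos (x 2) * (Tk κ₁ (x 0))⁻¹ * x 4 +
        Real.sin (x 2) * (Tk κ₁ (x 0))⁻¹ * (Tk κ₂ (x 1))⁻¹ * (Sk κ₂ (x 1))⁻¹ * x 5,
      -(κ₂ * Sk κ₂ (x 1) * Real.sin (x 2) * x 3) -
        Ck κ₂ (x 1) * Real.sin (x 2) * (Tk κ₁ (x 0))⁻¹ * x 4 -
        Real.cos (x 2) * (Tk κ₁ (x 0))⁻¹ * (Sk κ₂ (x 1))⁻¹ * x 5,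
      κ₂ * Sk κ₂ (x 1) * Real.cos (x 2),
      Ck κ₂ (x 1) * Real.cos (x 2) * (Tk κ₁ (x 0))⁻¹,
      -(Real.sin (x 2) * (Tk κ₁ (x 0))⁻¹ * (Sk κ₂ (x 1))⁻¹)] x := by
  have K := HasGrad.const κ₂ x
  have u := HasGrad.comp_coord (j := 0) (hasDerivAt_inv_Tk h₁)
  have S := HasGrad.comp_coord (j := 1) (hasDerivAt_Sk κ₂ (x 1))
  have C := HasGrad.comp_coord (j := 1) (hasDerivAt_Ck κ₂ (x 1))
  have w := HasGrad.comp_coord (j := 1) (hasDerivAt_inv_Sk h₂)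
  have c := HasGrad.comp_coord (j := 2) (Real.hasDerivAt_cos (x 2))
  have s := HasGrad.comp_coord (j := 2) (Real.hasDerivAt_sin (x 2))
  have p := HasGrad.coord 3 x
  have q := HasGrad.coord 4 x
  have m := HasGrad.coord 5 x
  refine (((((K.mul S).mul c).mul p).add (((C.mul c).mul u).mul q)).sub (((s.mul u).mul w).mul
    m)).congr (fun y => ?_) fun i => ?_
  · simp only [J02, div_eq_mul_inv, mul_inv]
    ring
  · fin_cases i <;> simp <;> ring

theorem hasGrad_J03 (h₁ : Sk κ₁ (x 0) ≠ 0) (h₂ : Sk κ₂ (x 1) ≠ 0) :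
    HasGrad (J03 κ₁ κ₂) ![-(Ck κ₂ (x 1) * Real.sin (x 2) * (Sk κ₁ (x 0))⁻¹ ^ 2 * x 4) -
      Real.cos (x 2) * (Sk κ₂ (x 1))⁻¹ * (Sk κ₁ (x 0))⁻¹ ^ 2 * x 5,
      κ₂ * Ck κ₂ (x 1) * Real.sin (x 2) * x 3 -
        κ₂ * Sk κ₂ (x 1) * Real.sin (x 2) * (Tk κ₁ (x 0))⁻¹ * x 4 -
        Real.cos (x 2) * (Tk κ₁ (x 0))⁻¹ * (Tk κ₂ (x 1))⁻¹ * (Sk κ₂ (x 1))⁻¹ * x 5,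
      κ₂ * Sk κ₂ (x 1) * Real.cos (x 2) * x 3 +
        Ck κ₂ (x 1) * Real.cos (x 2) * (Tk κ₁ (x 0))⁻¹ * x 4 -
        Real.sin (x 2) * (Tk κ₁ (x 0))⁻¹ * (Sk κ₂ (x 1))⁻¹ * x 5,
      κ₂ * Sk κ₂ (x 1) * Real.sin (x 2),
      Ck κ₂ (x 1) * Real.sin (x 2) * (Tk κ₁ (x 0))⁻¹,
      Real.cos (x 2) * (Tk κ₁ (x 0))⁻¹ * (Sk κ₂ (x 1))⁻¹] x := by
  have K := HasGrad.const κ₂ x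
  have u := HasGrad.comp_coord (j := 0) (hasDerivAt_inv_Tk h₁)
  have S := HasGrad.comp_coord (j := 1) (hasDerivAt_Sk κ₂ (x 1))
  have C := HasGrad.comp_coord (j := 1) (hasDerivAt_Ck κ₂ (x 1))
  have w := HasGrad.comp_coord (j := 1) (hasDerivAt_inv_Sk h₂)
  have c := HasGrad.comp_coord (j := 2) (Real.hasDerivAt_cos (x 2))
  have s := HasGrad.comp_coord (j := 2) (Real.hasDerivAt_sin (x 2))
  have p := HasGrad.coord 3 x
  have q := HasGrad.coord 4 x
  have m := HasGrad.coord 5 x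
  refine (((((K.mul S).mul s).mul p).add (((C.mul s).mul u).mul q)).add
    (((c.mul u).mul w).mul m)).congr (fun y => ?_) fun i => ?_
  · simp only [J03, div_eq_mul_inv, mul_inv]
    ring
  · fin_cases i <;> simp <;> ring

theorem hasGrad_J12 (h₂ : Sk κ₂ (x 1) ≠ 0) :
    HasGrad (J12 κ₂) ![0,
      Real.sin (x 2) * (Sk κ₂ (x 1))⁻¹ ^ 2 * x 5,
      -(Real.sin (x 2) * x 4) - Real.cos (x 2) * (Tk κ₂ (x 1))⁻¹ * x 5,
      0,
      Real.cos (x 2),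
      -(Real.sin (x 2) * (Tk κ₂ (x 1))⁻¹)] x := by
  have t := HasGrad.comp_coord (j := 1) (hasDerivAt_inv_Tk h₂)
  have c := HasGrad.comp_coord (j := 2) (Real.hasDerivAt_cos (x 2))
  have s := HasGrad.comp_coord (j := 2) (Real.hasDerivAt_sin (x 2))
  have q := HasGrad.coord 4 x
  have m := HasGrad.coord 5 x
  refine ((c.mul q).sub ((s.mul t).mul m)).congr (fun y => ?_) fun i => ?_
  · simp only [J12, div_eq_mul_inv]
  · fin_cases i <;> simp <;> ring

theorem hasGrad_J13 (h₂ : Sk κ₂ (x 1) ≠ 0) :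
    HasGrad (J13 κ₂) ![0,
      -(Real.cos (x 2) * (Sk κ₂ (x 1))⁻¹ ^ 2 * x 5),
      Real.cos (x 2) * x 4 - Real.sin (x 2) * (Tk κ₂ (x 1))⁻¹ * x 5,
      0,
      Real.sin (x 2),
      Real.cos (x 2) * (Tk κ₂ (x 1))⁻¹] x := by
  have t := HasGrad.comp_coord (j := 1) (hasDerivAt_inv_Tk h₂)
  have c := HasGrad.comp_coord (j := 2) (Real.hasDerivAt_cos (x 2))
  have s := HasGrad.comp_coord (j := 2) (Real.hasDerivAt_sin (x 2))
  have q := HasGrad.coord 4 x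
  have m := HasGrad.coord 5 x
  refine ((s.mul q).add ((c.mul t).mul m)).congr (fun y => ?_) fun i => ?_
  · simp only [J13, div_eq_mul_inv]
  · fin_cases i <;> simp <;> ring

theorem hasGrad_Tkin (h₁ : Sk κ₁ (x 0) ≠ 0) (h₂ : Sk κ₂ (x 1) ≠ 0) :
    HasGrad (Tkin κ₁ κ₂) ![-(κ₂⁻¹ * (Tk κ₁ (x 0))⁻¹ * (Sk κ₁ (x 0))⁻¹ ^ 2 * (x 4 ^ 2 +
      (Sk κ₂ (x 1))⁻¹ ^ 2 * x 5 ^ 2)),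
      -(κ₂⁻¹ * (Sk κ₁ (x 0))⁻¹ ^ 2 * (Tk κ₂ (x 1))⁻¹ * (Sk κ₂ (x 1))⁻¹ ^ 2 * x 5 ^ 2),
      0,
      x 3,
      κ₂⁻¹ * (Sk κ₁ (x 0))⁻¹ ^ 2 * x 4,
      κ₂⁻¹ * (Sk κ₁ (x 0))⁻¹ ^ 2 * (Sk κ₂ (x 1))⁻¹ ^ 2 * x 5] x := by
  have v := HasGrad.comp_coord (j := 0) (hasDerivAt_inv_Sk h₁)
  have w := HasGrad.comp_coord (j := 1) (hasDerivAt_inv_Sk h₂)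
  have p := HasGrad.coord 3 x
  have q := HasGrad.coord 4 x
  have m := HasGrad.coord 5 x
  have K := HasGrad.const κ₂⁻¹ x
  have h := HasGrad.const (1 / 2) x
  refine (h.mul ((p.mul p).add
    (K.mul ((v.mul v).mul ((q.mul q).add ((w.mul w).mul (m.mul m))))))).congr
    (fun y => ?_) fun i => ?_
  · simp only [Tkin, div_eq_mul_inv, mul_inv]
    ring
  · fin_cases i <;> simp <;> ring

end Gradients

theorem pb_L1_HGKC1 {κ₁ κ₂ : ℝ} {x : Pt} (k β₂ β₃ : ℝ) (hκ₂ : κ₂ ≠ 0)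
    (hx : x ∈ D κ₁ κ₂) :
    pb (L1 κ₁ κ₂ k β₂ β₃) (HGKC1 κ₁ κ₂ k β₂ β₃) x = 0 := by
  obtain ⟨h₁, -, h₂, -, hc, hs⟩ := hx
  have u := HasGrad.comp_coord (j := 0) (hasDerivAt_inv_Tk h₁)
  have v := HasGrad.comp_coord (j := 0) (hasDerivAt_inv_Sk h₁)
  have C := HasGrad.comp_coord (j := 1) (hasDerivAt_Ck κ₂ (x 1))
  have w := HasGrad.comp_coord (j := 1) (hasDerivAt_inv_Sk h₂)
  have a := HasGrad.comp_coord (j := 2) (hasDerivAt_inv_cos hc)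
  have b := HasGrad.comp_coord (j := 2) (hasDerivAt_inv_sin hs)
  have hJ02 := hasGrad_J02 h₁ h₂
  have hJ03 := hasGrad_J03 h₁ h₂
  have hJ12 := hasGrad_J12 h₂
  have hJ13 := hasGrad_J13 h₂
  have T := hasGrad_Tkin h₁ h₂
  have const := fun r : ℝ => HasGrad.const r x
  have L := HasGrad.congr (f₂ := L1 κ₁ κ₂ k β₂ β₃)
    (((((const 0).sub (hJ02.mul hJ12)).sub (hJ03.mul hJ13)).add ((const (k * κ₂)).mul C)).sub
      (((const (2 * κ₂)).mul (C.mul (u.mul (w.mul w)))).mul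
        (((const β₂).mul (a.mul a)).add ((const β₃).mul (b.mul b)))))
    (fun y => by simp only [L1, div_eq_mul_inv, mul_inv]; ring) fun _ => rfl
  have H := HasGrad.congr (f₂ := HGKC1 κ₁ κ₂ k β₂ β₃)
    ((T.sub ((const k).mul u)).add
      (((v.mul v).mul (w.mul w)).mul (((const β₂).mul (a.mul a)).add ((const β₃).mul (b.mul b)))))
    (fun y => by simp only [HGKC1, div_eq_mul_inv, mul_inv]; ring) fun _ => rfl
  rw [L.pb_eq H]
  simp only [Pi.add_apply, Pi.sub_apply, Pi.smul_apply, smul_eq_mul, Pi.zero_apply]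
  simp [J02, J03, J12, J13, Tk]
  have e₁ := Ck_sq_add_Sk_sq κ₂ (x 1)
  have e₂ := Real.sin_sq_add_cos_sq (x 2)
  clear * - e₁ e₂ h₁ h₂ hc hs hκ₂
  field_simp
  grind

theorem pb_L2_HGKC2 {κ₁ κ₂ : ℝ} {x : Pt} (k β₁ β₃ : ℝ) (hκ₂ : κ₂ ≠ 0)
    (hx : x ∈ D κ₁ κ₂) :
    pb (L2 κ₁ κ₂ k β₁ β₃) (HGKC2 κ₁ κ₂ k β₁ β₃) x = 0 := by
  obtain ⟨h₁, -, h₂, h₃, hc, hs⟩ := hx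
  have u := HasGrad.comp_coord (j := 0) (hasDerivAt_inv_Tk h₁)
  have v := HasGrad.comp_coord (j := 0) (hasDerivAt_inv_Sk h₁)
  have S := HasGrad.comp_coord (j := 1) (hasDerivAt_Sk κ₂ (x 1))
  have w := HasGrad.comp_coord (j := 1) (hasDerivAt_inv_Sk h₂)
  have z := HasGrad.comp_coord (j := 1) (hasDerivAt_inv_Ck h₃)
  have c := HasGrad.comp_coord (j := 2) (Real.hasDerivAt_cos (x 2))
  have b := HasGrad.comp_coord (j := 2) (hasDerivAt_inv_sin hs)
  have hJ01 := hasGrad_J01 (κ₂ := κ₂) h₁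
  have hJ03 := hasGrad_J03 h₁ h₂
  have hJ12 := hasGrad_J12 h₂
  have hJ23 := HasGrad.coord 5 x
  have T := hasGrad_Tkin h₁ h₂
  have const := fun r : ℝ => HasGrad.const r x
  have L := HasGrad.congr (f₂ := L2 κ₁ κ₂ k β₁ β₃)
    ((((hJ01.mul hJ12).sub (hJ03.mul hJ23)).add ((const (k * κ₂)).mul (S.mul c))).sub
      (((const (2 * κ₂)).mul (c.mul u)).mul
        (((const β₁).mul (S.mul (z.mul z))).add ((const β₃).mul (w.mul (b.mul b))))))
    (fun y => by simp only [L2, J23, div_eq_mul_inv, mul_inv]; ring) fun _ => rfl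
  have H := HasGrad.congr (f₂ := HGKC2 κ₁ κ₂ k β₁ β₃)
    ((T.sub ((const k).mul u)).add
      ((v.mul v).mul (((const β₁).mul (z.mul z)).add ((const β₃).mul ((w.mul w).mul (b.mul b))))))
    (fun y => by simp only [HGKC2, div_eq_mul_inv, mul_inv]; ring) fun _ => rfl
  rw [L.pb_eq H]
  simp only [Pi.add_apply, Pi.sub_apply, Pi.smul_apply, smul_eq_mul, Pi.zero_apply]
  simp [J01, J03, J12, Tk]
  have e₁ := Ck_sq_add_Sk_sq κ₂ (x 1)
  have e₂ := Real.sin_sq_add_cos_sq (x 2)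
  clear * - e₁ e₂ h₁ h₂ h₃ hc hs hκ₂
  field_simp
  grind

theorem pb_L3_HGKC3 {κ₁ κ₂ : ℝ} {x : Pt} (k β₁ β₂ : ℝ) (hκ₂ : κ₂ ≠ 0)
    (hx : x ∈ D κ₁ κ₂) :
    pb (L3 κ₁ κ₂ k β₁ β₂) (HGKC3 κ₁ κ₂ k β₁ β₂) x = 0 := by
  obtain ⟨h₁, -, h₂, h₃, hc, hs⟩ := hx
  have u := HasGrad.comp_coord (j := 0) (hasDerivAt_inv_Tk h₁)
  have v := HasGrad.comp_coord (j := 0) (hasDerivAt_inv_Sk h₁)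
  have S := HasGrad.comp_coord (j := 1) (hasDerivAt_Sk κ₂ (x 1))
  have w := HasGrad.comp_coord (j := 1) (hasDerivAt_inv_Sk h₂)
  have z := HasGrad.comp_coord (j := 1) (hasDerivAt_inv_Ck h₃)
  have s := HasGrad.comp_coord (j := 2) (Real.hasDerivAt_sin (x 2))
  have a := HasGrad.comp_coord (j := 2) (hasDerivAt_inv_cos hc)
  have hJ01 := hasGrad_J01 (κ₂ := κ₂) h₁
  have hJ02 := hasGrad_J02 h₁ h₂
  have hJ13 := hasGrad_J13 h₂
  have hJ23 := HasGrad.coord 5 x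
  have T := hasGrad_Tkin h₁ h₂
  have const := fun r : ℝ => HasGrad.const r x
  have L := HasGrad.congr (f₂ := L3 κ₁ κ₂ k β₁ β₂)
    ((((hJ01.mul hJ13).add (hJ02.mul hJ23)).add ((const (k * κ₂)).mul (S.mul s))).sub
      (((const (2 * κ₂)).mul (s.mul u)).mul
        (((const β₁).mul (S.mul (z.mul z))).add ((const β₂).mul (w.mul (a.mul a))))))
    (fun y => by simp only [L3, J23, div_eq_mul_inv, mul_inv]; ring) fun _ => rfl
  have H := HasGrad.congr (f₂ := HGKC3 κ₁ κ₂ k β₁ β₂)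
    ((T.sub ((const k).mul u)).add
      ((v.mul v).mul (((const β₁).mul (z.mul z)).add ((const β₂).mul ((w.mul w).mul (a.mul a))))))
    (fun y => by simp only [HGKC3, div_eq_mul_inv, mul_inv]; ring) fun _ => rfl
  rw [L.pb_eq H]
  simp only [Pi.add_apply, Pi.sub_apply, Pi.smul_apply, smul_eq_mul, Pi.zero_apply]
  simp [J01, J02, J13, Tk]
  have e₁ := Ck_sq_add_Sk_sq κ₂ (x 1)
  have e₂ := Real.sin_sq_add_cos_sq (x 2)
  clear * - e₁ e₂ h₁ h₂ h₃ hc hs hκ₂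
  field_simp
  grind

/-- for each i ∈ {1,2,3}, the function Lᵢ Poisson commutes with
the generalized Kepler–Coulomb Hamiltonian H^GKC_i at every point of D. -/
theorem GKC_extra_integral_commutes (κ₁ κ₂ k β₁ β₂ β₃ : ℝ) (hκ₂ : κ₂ ≠ 0) :
    ∀ x ∈ D κ₁ κ₂,
      pb (L1 κ₁ κ₂ k β₂ β₃) (HGKC1 κ₁ κ₂ k β₂ β₃) x = 0 ∧
      pb (L2 κ₁ κ₂ k β₁ β₃) (HGKC2 κ₁ κ₂ k β₁ β₃) x = 0 ∧
      pb (L3 κ₁ κ₂ k β₁ β₂) (HGKC3 κ₁ κ₂ k β₁ β₂) x = 0 := by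
  exact fun x hx => ⟨pb_L1_HGKC1 k β₂ β₃ hκ₂ hx, pb_L2_HGKC2 k β₁ β₃ hκ₂ hx,
    pb_L3_HGKC3 k β₁ β₂ hκ₂ hx⟩

end
end Paper
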